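/- arXiv:2502.07795 — 3 statements merged into one kernel-verified Lean document; each statement's English description precedes it below -/
import Mathlib

section
/- Let f be a compact subset, of positive two-dimensional Hausdorff measure, of a plane in ℝ³, and let w : f → [0,∞) be a bounded measurable function for which there exist a nonempty subset f̂ ⊂ f that is open in the plane and a constant ρ₁ > 0 with w ≥ ρ₁ on f̂. Then for every integer k ≥ 0 there exists a constant C, depending only on f, w and k, such that ∫_f |p|² dμ ≤ C ∫_f w |p|² dμ for every real polynomial p in three variables of total degree at most k, where μ denotes the two-dimensional Hausdorff measure. -/
open MeasureTheory

noncomputable section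

/-- `ℝ³` as a Euclidean space. -/
abbrev E3 : Type := EuclideanSpace ℝ (Fin 3)

/-- The Euclidean dot product on `ℝ³`. -/
def dot3 (a b : E3) : ℝ := ∑ i : Fin 3, a i * b i

/-- The cross product on `ℝ³`. -/
def cross3 (a b : E3) : E3 :=
  (EuclideanSpace.equiv (Fin 3) ℝ).symm
    ![a 1 * b 2 - a 2 * b 1, a 2 * b 0 - a 0 * b 2, a 0 * b 1 - a 1 * b 0]

/-- Partial derivative in the `i`-th coordinate direction. -/
def pd (i : Fin 3) (f : E3 → ℝ) (x : E3) : ℝ := fderiv ℝ f x (EuclideanSpace.single i 1)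

/-- The gradient of a scalar field on `ℝ³`. -/
def grad3 (f : E3 → ℝ) (x : E3) : E3 :=
  (EuclideanSpace.equiv (Fin 3) ℝ).symm ![pd 0 f x, pd 1 f x, pd 2 f x]

/-- The divergence of a vector field on `ℝ³`. -/
def div3 (v : E3 → E3) (x : E3) : ℝ := ∑ i : Fin 3, pd i (fun y => v y i) x

/-- The curl of a vector field on `ℝ³`. -/
def curl3 (v : E3 → E3) (x : E3) : E3 :=
  (EuclideanSpace.equiv (Fin 3) ℝ).symm
    ![pd 1 (fun y => v y 2) x - pd 2 (fun y => v y 1) x,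
      pd 2 (fun y => v y 0) x - pd 0 (fun y => v y 2) x,
      pd 0 (fun y => v y 1) x - pd 1 (fun y => v y 0) x]

/-- The curl-curl operator `(∇×)²`. -/
def curlcurl3 (v : E3 → E3) : E3 → E3 := curl3 (curl3 v)

/-- `f : ℝ³ → ℝ` is (globally) a real polynomial of total degree at most `k`. -/
def PolyFun (k : ℕ) (f : E3 → ℝ) : Prop :=
  ∃ p : MvPolynomial (Fin 3) ℝ, p.totalDegree ≤ k ∧
    ∀ x : E3, f x = MvPolynomial.eval (fun i => x i) p

/-- `v : ℝ³ → ℝ³` is componentwise a polynomial of total degree at most `k`. -/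
def PolyVec (k : ℕ) (v : E3 → E3) : Prop := ∀ c : Fin 3, PolyFun k (fun x => v x c)

/-- A (possibly non-convex) polyhedral element in `ℝ³`: a nonempty bounded open set whose
boundary is the union of `N` planar compact faces of positive two-dimensional Hausdorff
measure, with outward unit normals. -/
structure PolyhedralElement (N : ℕ) where
  carrier : Set E3
  face : Fin N → Set E3
  normal : Fin N → E3
  basept : Fin N → E3
  carrier_nonempty : carrier.Nonempty
  carrier_isOpen : IsOpen carrier
  carrier_isBounded : Bornology.IsBounded carrier
  frontier_eq : frontier carrier = ⋃ i, face i
  face_isCompact : ∀ i, IsCompact (face i)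
  face_pos : ∀ i, 0 < μH[(2 : ℝ)] (face i)
  face_inter_null : ∀ i j, i ≠ j → μH[(2 : ℝ)] (face i ∩ face j) = 0
  normal_unit : ∀ i, ‖normal i‖ = 1
  basept_mem : ∀ i, basept i ∈ face i
  face_planar : ∀ i, ∀ x ∈ face i, dot3 (x - basept i) (normal i) = 0
  normal_outward : ∀ i, ∀ x ∈ face i, (∀ j, j ≠ i → x ∉ face j) →
    ∃ ε > (0 : ℝ), ∀ t : ℝ, 0 < t → t < ε →
      x + t • normal i ∉ carrier ∧ x - t • normal i ∈ carrier

namespace PolyhedralElement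

variable {N : ℕ} (P : PolyhedralElement N)

/-- The element size `h_T = diam T`. -/
def hT : ℝ := Metric.diam P.carrier

/-- The affine function `l_i(x) = (x − A_i)·n_i / h_T`, vanishing on face `f_i`. -/
def lfun (i : Fin N) (x : E3) : ℝ := dot3 (x - P.basept i) (P.normal i) / P.hT

/-- The element bubble function `Φ_B = l₁² ⋯ l_N²`. -/
def bubble (x : E3) : ℝ := ∏ i, (P.lfun i x) ^ 2

/-- The face bubble function `φ_{f_j} = ∏_{i ≠ j} l_i²`. -/
def faceBubble (j : Fin N) (x : E3) : ℝ := ∏ i ∈ Finset.univ.erase j, (P.lfun i x) ^ 2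

/-- Orthogonal projection of `ℝ³` onto the plane of face `f_j`. -/
def faceProj (j : Fin N) (x : E3) : E3 :=
  x - dot3 (x - P.basept j) (P.normal j) • P.normal j

/-- `nv` is (a version of) the outward unit normal field on `∂T`: on the boundary it always
equals one of the face normals, and at every point lying on exactly one face it equals the
outward normal of that face. -/
def IsOutwardNormal (nv : E3 → E3) : Prop :=
  Measurable nv ∧
  (∀ x ∈ frontier P.carrier, ∃ i, x ∈ P.face i ∧ nv x = P.normal i) ∧
  (∀ i, ∀ x ∈ P.face i, (∀ j, j ≠ i → x ∉ P.face j) → nv x = P.normal i)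

/-- `G` is the discrete weak gradient `∇_{w,r,T}{σ₀, σ_b}`. -/
def IsWeakGradient (r : ℕ) (nv : E3 → E3) (σ₀ σb : E3 → ℝ) (G : E3 → E3) : Prop :=
  PolyVec r G ∧
  ∀ ψ : E3 → E3, PolyVec r ψ →
    (∫ x in P.carrier, dot3 (G x) (ψ x)) =
      -(∫ x in P.carrier, σ₀ x * div3 ψ x) +
      ∫ x in frontier P.carrier, σb x * dot3 (ψ x) (nv x) ∂(μH[(2 : ℝ)])

/-- `G` is the discrete weak curl-curl `(∇×)²_{w,r,T}{v₀, v_b, v_n}`. -/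
def IsWeakCurlCurl (r : ℕ) (nv : E3 → E3) (v₀ vb vn : E3 → E3) (G : E3 → E3) : Prop :=
  PolyVec r G ∧
  ∀ q : E3 → E3, PolyVec r q →
    (∫ x in P.carrier, dot3 (G x) (q x)) =
      (∫ x in P.carrier, dot3 (v₀ x) (curlcurl3 q x))
      - (∫ x in frontier P.carrier, dot3 (cross3 (vb x) (nv x)) (curl3 q x) ∂(μH[(2 : ℝ)]))
      - ∫ x in frontier P.carrier, dot3 (cross3 (vn x) (nv x)) (q x) ∂(μH[(2 : ℝ)])

end PolyhedralElement

/-- On a finite-dimensional space, a linear map is bounded by any other linear map whose kernel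
is smaller. -/
theorem exists_norm_le_mul_norm_of_ker_le {V E F : Type*} [AddCommGroup V] [Module ℝ V]
    [FiniteDimensional ℝ V] [NormedAddCommGroup E] [NormedSpace ℝ E]
    [NormedAddCommGroup F] [NormedSpace ℝ F] (S : V →ₗ[ℝ] E) (T : V →ₗ[ℝ] F)
    (h : LinearMap.ker T ≤ LinearMap.ker S) :
    ∃ C : ℝ, ∀ v, ‖S v‖ ≤ C * ‖T v‖ := by
  let R : LinearMap.range T →ₗ[ℝ] E :=
    (LinearMap.ker T).liftQ S h ∘ₗ T.quotKerEquivRange.symm.toLinearMap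
  have hR (v : V) : R ⟨T v, LinearMap.mem_range_self T v⟩ = S v := by
    simp [R, LinearMap.quotKerEquivRange_symm_apply_image]
  refine ⟨‖R.toContinuousLinearMap‖, fun v ↦ ?_⟩
  simpa [hR] using R.toContinuousLinearMap.le_opNorm ⟨T v, LinearMap.mem_range_self T v⟩

/-- The squared norm of the `L²` class of a real function is the integral of its square. -/
theorem norm_toLp_two_sq {X : Type*} [MeasurableSpace X] {μ : Measure X} {g : X → ℝ}
    (hg : MemLp g 2 μ) : ‖hg.toLp g‖ ^ 2 = ∫ x, g x ^ 2 ∂μ := by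
  rw [← real_inner_self_eq_norm_sq, L2.inner_def]
  refine integral_congr_ae ?_
  filter_upwards [hg.coeFn_toLp] with x hx
  simp [hx, sq]

/-- For a finite-dimensional family of functions that are square integrable with respect to `μ`
and `ν`, the `L²(μ)` norm is controlled by the `L²(ν)` norm as soon as `ν`-null members of the
family are `μ`-null. -/
theorem exists_integral_sq_le_mul_integral_sq {V X : Type*} [AddCommGroup V] [Module ℝ V]
    [FiniteDimensional ℝ V] [MeasurableSpace X] {μ ν : Measure X} (Φ : V →ₗ[ℝ] X → ℝ)
    (hμ : ∀ v, MemLp (Φ v) 2 μ) (hν : ∀ v, MemLp (Φ v) 2 ν)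
    (h : ∀ v, Φ v =ᵐ[ν] 0 → Φ v =ᵐ[μ] 0) :
    ∃ C : ℝ, 0 ≤ C ∧ ∀ v, ∫ x, Φ v x ^ 2 ∂μ ≤ C * ∫ x, Φ v x ^ 2 ∂ν := by
  let toL2 (m : Measure X) (hm : ∀ v, MemLp (Φ v) 2 m) : V →ₗ[ℝ] Lp ℝ 2 m :=
    { toFun := fun v ↦ (hm v).toLp (Φ v)
      map_add' := fun u v ↦ by
        rw [← MemLp.toLp_add]
        exact MemLp.toLp_congr _ _ (by simp)
      map_smul' := fun c v ↦ by
        rw [RingHom.id_apply, ← MemLp.toLp_const_smul]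
        exact MemLp.toLp_congr _ _ (by simp) }
  have hker : LinearMap.ker (toL2 ν hν) ≤ LinearMap.ker (toL2 μ hμ) := fun v hv ↦ by
    have hv : (hν v).toLp (Φ v) = 0 := hv
    have hvν : Φ v =ᵐ[ν] 0 := (hν v).coeFn_toLp.symm.trans (by rw [hv]; exact Lp.coeFn_zero ..)
    exact (MemLp.toLp_congr (hμ v) MemLp.zero (h v hvν)).trans (MemLp.toLp_zero _)
  obtain ⟨C, hC⟩ := exists_norm_le_mul_norm_of_ker_le _ _ hker
  refine ⟨C ^ 2, sq_nonneg C, fun v ↦ ?_⟩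
  rw [← norm_toLp_two_sq (hμ v), ← norm_toLp_two_sq (hν v), ← mul_pow]
  exact pow_le_pow_left₀ (norm_nonneg _) (hC v) 2

/-- A polynomial that vanishes at all points of the line through `a` and `b` close to `a`
vanishes at `b`. -/
theorem MvPolynomial.eval_eq_zero_of_eventually_lineMap {σ : Type*} (p : MvPolynomial σ ℝ)
    (a b : σ → ℝ)
    (h : ∀ᶠ t in nhds (0 : ℝ), MvPolynomial.eval (AffineMap.lineMap a b t) p = 0) :
    MvPolynomial.eval b p = 0 := by
  let q : Polynomial ℝ :=
    MvPolynomial.aeval (fun i ↦ Polynomial.C (b i - a i) * Polynomial.X + Polynomial.C (a i)) p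
  have hq (t : ℝ) : q.eval t = MvPolynomial.eval (AffineMap.lineMap a b t) p := by
    rw [← Polynomial.coe_evalRingHom, MvPolynomial.map_aeval, MvPolynomial.eval]
    congr 2
    · ext; simp
    · ext i; simp [AffineMap.lineMap_apply]; ring
  have hq0 : q = 0 := by
    refine Polynomial.eq_zero_of_infinite_isRoot q (infinite_of_mem_nhds (0 : ℝ) ?_)
    filter_upwards [h] with t ht
    rw [Polynomial.IsRoot, hq, ht]
  simpa [hq0] using (hq 1).symm

/-- The orthogonal complement of a line in `ℝ³` parametrizes the parallel plane through `A`. -/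
theorem range_const_add_orthogonal (A n : E3) :
    Set.range (fun v : (ℝ ∙ n)ᗮ ↦ A + (v : E3)) = {x : E3 | dot3 (x - A) n = 0} := by
  have hdot (x : E3) : dot3 x n = inner ℝ n x := by
    simp [dot3, PiLp.inner_apply]
  ext x
  rw [Set.mem_ofPred_eq, hdot, ← Submodule.mem_orthogonal_singleton_iff_inner_right]
  constructor
  · rintro ⟨v, rfl⟩
    simp
  · exact fun hx ↦ ⟨⟨x - A, hx⟩, by simp⟩

theorem isometry_const_add_coe (A : E3) (W : Submodule ℝ E3) :
    Isometry (fun v : W ↦ A + (v : E3)) :=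
  (isometry_add_left A).comp isometry_subtype_coe

theorem isAddHaarMeasure_hausdorffMeasure_two_orthogonal {n : E3} (hn : n ≠ 0) :
    (μH[(2 : ℝ)] : Measure (ℝ ∙ n)ᗮ).IsAddHaarMeasure := by
  have : Fact (Module.finrank ℝ E3 = 2 + 1) := ⟨by simp⟩
  have h := isAddHaarMeasure_hausdorffMeasure (E := (ℝ ∙ n)ᗮ)
  rwa [Submodule.finrank_orthogonal_span_singleton (n := 2) hn, Nat.cast_ofNat] at h

theorem hausdorffMeasure_two_lt_top_of_subset_plane {A n : E3} (hn : n ≠ 0) {f : Set E3}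
    (hf : IsCompact f) (hsub : f ⊆ {x : E3 | dot3 (x - A) n = 0}) :
    μH[(2 : ℝ)] f < ⊤ := by
  have := isAddHaarMeasure_hausdorffMeasure_two_orthogonal hn
  have hg := isometry_const_add_coe A (ℝ ∙ n)ᗮ
  rw [← range_const_add_orthogonal] at hsub
  rw [← Set.image_preimage_eq_of_subset hsub, hg.hausdorffMeasure_image (.inl zero_le_two)]
  exact (hg.isClosedEmbedding.isCompact_preimage hf).measure_lt_top

theorem hausdorffMeasure_two_inter_plane_pos {A n : E3} (hn : n ≠ 0) {U : Set E3}
    (hU : IsOpen U) (hne : (U ∩ {x : E3 | dot3 (x - A) n = 0}).Nonempty) :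
    0 < μH[(2 : ℝ)] (U ∩ {x : E3 | dot3 (x - A) n = 0}) := by
  have := isAddHaarMeasure_hausdorffMeasure_two_orthogonal hn
  have hg := isometry_const_add_coe A (ℝ ∙ n)ᗮ
  rw [← range_const_add_orthogonal] at hne ⊢
  rw [← Set.image_preimage_eq_inter_range, hg.hausdorffMeasure_image (.inl zero_le_two)]
  obtain ⟨_, hx, v, rfl⟩ := hne
  exact (hU.preimage hg.continuous).measure_pos _ ⟨v, hx⟩

/-- A polynomial that vanishes almost everywhere on a nonempty relatively open subset of a plane
vanishes on the whole plane. -/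
theorem eval_eq_zero_of_ae_eq_zero_inter_plane {A n : E3} (hn : n ≠ 0) {U : Set E3}
    (hU : IsOpen U) (hne : (U ∩ {x : E3 | dot3 (x - A) n = 0}).Nonempty)
    (p : MvPolynomial (Fin 3) ℝ)
    (hp : ∀ᵐ x : E3 ∂(μH[(2 : ℝ)]).restrict (U ∩ {x : E3 | dot3 (x - A) n = 0}),
      MvPolynomial.eval (fun i ↦ x i) p = 0)
    {b : E3} (hb : dot3 (b - A) n = 0) :
    MvPolynomial.eval (fun i ↦ b i) p = 0 := by
  have hcont : Continuous fun x : E3 ↦ MvPolynomial.eval (fun i ↦ x i) p :=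
    (MvPolynomial.continuous_eval p).comp (by fun_prop)
  have hzero (x : E3) (hxU : x ∈ U) (hx : dot3 (x - A) n = 0) :
      MvPolynomial.eval (fun i ↦ x i) p = 0 := by
    by_contra hpx
    have hopen : IsOpen {y : E3 | MvPolynomial.eval (fun i ↦ y i) p ≠ 0} :=
      isOpen_ne_fun hcont continuous_const
    refine (hausdorffMeasure_two_inter_plane_pos hn (hopen.inter hU) ⟨x, ⟨hpx, hxU⟩, hx⟩).ne' ?_
    rw [Set.inter_assoc, ← Measure.restrict_apply hopen.measurableSet]
    exact hp
  obtain ⟨a, haU, ha⟩ := hne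
  refine MvPolynomial.eval_eq_zero_of_eventually_lineMap p (fun i ↦ a i) _ ?_
  have hline : Continuous fun t : ℝ ↦ (AffineMap.lineMap a b t : E3) :=
    AffineMap.lineMap_continuous
  have hmem : ∀ᶠ t in nhds (0 : ℝ), (AffineMap.lineMap a b t : E3) ∈ U :=
    hline.continuousAt.eventually_mem (hU.mem_nhds (by simpa using haU))
  filter_upwards [hmem] with t ht
  have hplane : dot3 ((AffineMap.lineMap a b t : E3) - A) n = 0 := by
    have ha : dot3 (a - A) n = 0 := ha
    simp only [dot3, Fin.sum_univ_three, AffineMap.lineMap_apply, vsub_eq_sub, vadd_eq_add,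
      PiLp.sub_apply, PiLp.add_apply, PiLp.smul_apply, smul_eq_mul] at ha hb ⊢
    linear_combination (1 - t) * ha + t * hb
  convert hzero _ ht hplane using 3
  ext i
  simp [AffineMap.lineMap_apply]

/-- face version of the domain inverse inequality.  If `f` is a compact subset of
positive `μH²`-measure of a plane in `ℝ³`, and `w ≥ 0` is a bounded measurable weight on `f`
bounded below by `ρ₁ > 0` on a nonempty relatively open subset `f' ⊆ f`, then for every `k`
there is a constant `C` with `∫_f p² dμH² ≤ C ∫_f w p² dμH²` for all polynomials `p` of total
degree at most `k`. -/
theorem statement3 (A n : E3) (hn : ‖n‖ = 1)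
    (f : Set E3) (hf_sub : f ⊆ {x : E3 | dot3 (x - A) n = 0})
    (hf_cpt : IsCompact f) (hf_pos : 0 < μH[(2 : ℝ)] f)
    (w : E3 → ℝ) (hw_meas : Measurable w)
    (hw_nonneg : ∀ x ∈ f, 0 ≤ w x) (hw_bdd : ∃ M : ℝ, ∀ x ∈ f, w x ≤ M)
    (f' : Set E3) (hf'_sub : f' ⊆ f) (hf'_ne : f'.Nonempty)
    (hf'_open : ∃ U : Set E3, IsOpen U ∧ f' = U ∩ {x : E3 | dot3 (x - A) n = 0})
    (ρ₁ : ℝ) (hρ₁ : 0 < ρ₁) (hlb : ∀ x ∈ f', ρ₁ ≤ w x) (k : ℕ) :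
    ∃ C : ℝ, ∀ p : MvPolynomial (Fin 3) ℝ, p.totalDegree ≤ k →
      (∫ x in f, (MvPolynomial.eval (fun i => x i) p) ^ 2 ∂(μH[(2 : ℝ)])) ≤
        C * ∫ x in f, w x * (MvPolynomial.eval (fun i => x i) p) ^ 2 ∂(μH[(2 : ℝ)]) := by
  have hn0 : n ≠ 0 := by
    rintro rfl
    simp at hn
  obtain ⟨U, hU, rfl⟩ := hf'_open
  obtain ⟨M, hM⟩ := hw_bdd
  set P : Set E3 := {x : E3 | dot3 (x - A) n = 0}
  have hf_meas : MeasurableSet f := hf_cpt.measurableSet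
  have hP_meas : MeasurableSet P :=
    (isClosed_eq (by unfold dot3; fun_prop) continuous_const).measurableSet
  have hf'_meas : MeasurableSet (U ∩ P) := hU.measurableSet.inter hP_meas
  have : IsFiniteMeasure ((μH[(2 : ℝ)] : Measure E3).restrict f) :=
    ⟨by simpa using hausdorffMeasure_two_lt_top_of_subset_plane hn0 hf_cpt hf_sub⟩
  let Φ : MvPolynomial.restrictTotalDegree (Fin 3) ℝ k →ₗ[ℝ] E3 → ℝ :=
    { toFun := fun p x ↦ MvPolynomial.eval (fun i ↦ x i) p.1
      map_add' := fun p q ↦ by ext; simp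
      map_smul' := fun c p ↦ by ext; simp }
  have hcont (p) : Continuous (Φ p) :=
    (MvPolynomial.continuous_eval p.1).comp (by fun_prop)
  have hμ (p) : MemLp (Φ p) 2 ((μH[(2 : ℝ)]).restrict f) := by
    obtain ⟨B, hB⟩ := hf_cpt.exists_bound_of_continuousOn (hcont p).continuousOn
    exact .of_bound (hcont p).aestronglyMeasurable B ((ae_restrict_mem hf_meas).mono hB)
  have hle : (μH[(2 : ℝ)]).restrict (U ∩ P) ≤ (μH[(2 : ℝ)]).restrict f :=
    Measure.restrict_mono hf'_sub le_rfl
  obtain ⟨C, hC0, hC⟩ := exists_integral_sq_le_mul_integral_sq Φ hμ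
    (fun p ↦ (hμ p).mono_measure hle) fun p hp ↦ by
      filter_upwards [ae_restrict_mem hf_meas] with b hb
      exact eval_eq_zero_of_ae_eq_zero_inter_plane hn0 hU hf'_ne p.1 hp (hf_sub hb)
  refine ⟨C * ρ₁⁻¹, fun p hp ↦ ?_⟩
  let q : MvPolynomial.restrictTotalDegree (Fin 3) ℝ k :=
    ⟨p, (MvPolynomial.mem_restrictTotalDegree _ _ _).2 hp⟩
  have hint : Integrable (fun x ↦ w x * Φ q x ^ 2) ((μH[(2 : ℝ)]).restrict f) := by
    refine (hμ q).integrable_sq.bdd_mul (c := M) hw_meas.aestronglyMeasurable ?_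
    filter_upwards [ae_restrict_mem hf_meas] with x hx
    rw [Real.norm_of_nonneg (hw_nonneg x hx)]
    exact hM x hx
  have hweight : ρ₁ * ∫ x in U ∩ P, Φ q x ^ 2 ∂(μH[(2 : ℝ)]) ≤
      ∫ x in f, w x * Φ q x ^ 2 ∂(μH[(2 : ℝ)]) := by
    rw [← integral_const_mul]
    refine (integral_mono_ae (((hμ q).integrable_sq.mono_measure hle).const_mul ρ₁)
      (hint.mono_measure hle) ?_).trans (integral_mono_measure hle ?_ hint)
    · filter_upwards [ae_restrict_mem hf'_meas] with x hx
      exact mul_le_mul_of_nonneg_right (hlb x hx) (sq_nonneg _)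
    · filter_upwards [ae_restrict_mem hf_meas] with x hx
      exact mul_nonneg (hw_nonneg x hx) (sq_nonneg _)
  refine (hC q).trans ?_
  rw [mul_assoc]
  exact mul_le_mul_of_nonneg_left ((le_inv_mul_iff₀ hρ₁).2 hweight) hC0

end
end

section
/- Let T be a polyhedral element with faces f₁,…,f_N, fix a face f_j with unit normal n_j, and let π_j denote the orthogonal projection of ℝ³ onto the plane of f_j. Let k ≥ 0 be an integer, let σ₀ ∈ P_k(T), and let σ_b be a polynomial of total degree at most k on the plane of f_j. Define ψ : T → ℝ³ by ψ(X) = (σ_b − σ₀)(π_j(X)) · φ_{f_j}(X) · n_j, where σ_b − σ₀ is evaluated at the projected point π_j(X). Then there exists a constant C, depending only on T and k, such that ‖ψ‖²_{L²(T)} ≤ C h_T ∫_{f_j} (σ_b − σ₀)² dS. -/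
open MeasureTheory

noncomputable section

/-- A real-analytic function on `ℝ` whose zero set has positive measure vanishes identically. -/
theorem eq_zero_of_volume_zeros_ne_zero {f : ℝ → ℝ} (hf : AnalyticOnNhd ℝ f Set.univ)
    (h : volume {x | f x = 0} ≠ 0) (x : ℝ) : f x = 0 := by
  rcases hf.eqOn_zero_or_eventually_ne_zero_of_preconnected isPreconnected_univ with h0 | h0
  · exact h0 (Set.mem_univ x)
  · have := ae_restrict_le_codiscreteWithin (μ := (volume : Measure ℝ)) MeasurableSet.univ h0
    rw [Measure.restrict_univ] at this
    refine absurd ?_ h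
    simpa [mem_ae_iff, Set.compl_ofPred] using this

/-- A real-analytic function on `ℝ × ℝ` whose zero set has positive measure vanishes
identically. -/
theorem eq_zero_of_volume_zeros_prod_ne_zero {f : ℝ × ℝ → ℝ} (hf : AnalyticOnNhd ℝ f Set.univ)
    (h : volume {z | f z = 0} ≠ 0) (z : ℝ × ℝ) : f z = 0 := by
  have hmeas : MeasurableSet {z | f z = 0} :=
    (isClosed_eq hf.continuous continuous_const).measurableSet
  have hslice : ∀ a : ℝ, volume {b | f (a, b) = 0} ≠ 0 → ∀ b, f (a, b) = 0 := fun a ha =>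
    eq_zero_of_volume_zeros_ne_zero (f := fun b => f (a, b))
      (fun b _ => (hf (a, b) (Set.mem_univ _)).comp₂ analyticAt_const analyticAt_id) ha
  have hpos : volume {a : ℝ | volume {b | f (a, b) = 0} ≠ 0} ≠ 0 := by
    intro h0
    refine h ?_
    rw [Measure.volume_eq_prod, Measure.measure_prod_null hmeas]
    exact h0
  refine eq_zero_of_volume_zeros_ne_zero (f := fun a => f (a, z.2))
    (fun a _ => (hf (a, z.2) (Set.mem_univ _)).comp₂ analyticAt_id analyticAt_const) ?_ z.1
  exact fun h0 => hpos (measure_mono_null (fun a ha => hslice a ha z.2) h0)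

theorem dot3_eq_inner (a b : E3) : dot3 a b = inner ℝ b a := by
  simp [dot3, PiLp.inner_apply]

/-- The points of a plane in `ℝ³` are recovered from their coordinates along two vectors. -/
theorem exists_plane_coordinates {n : E3} (hn : ‖n‖ = 1) (A : E3) :
    ∃ u v : E3, ∀ x, dot3 (x - A) n = 0 →
      A + (inner ℝ u (x - A) • u + inner ℝ v (x - A) • v) = x := by
  obtain ⟨b, hb⟩ := Orthonormal.exists_orthonormalBasis_extension_of_card_eq (𝕜 := ℝ) (E := E3)
    (ι := Fin 3) (by simp) (v := fun _ => n) (s := {0}) (by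
      constructor
      · intro i; exact hn
      · intro i k hik; exact absurd (Subsingleton.elim i k) hik)
  refine ⟨b 1, b 2, fun x hx => ?_⟩
  have h := b.sum_repr' (x - A)
  rw [Fin.sum_univ_three, hb 0 rfl, ← dot3_eq_inner, hx, zero_smul, zero_add] at h
  rw [h, add_sub_cancel]

/-- The affine parametrization of the plane through `A` spanned by `u` and `v`. -/
def planeParam (A u v : E3) (z : ℝ × ℝ) : E3 := A + (z.1 • u + z.2 • v)

theorem exists_lipschitzWith_planeParam (A u v : E3) :
    ∃ K, LipschitzWith K (planeParam A u v) := by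
  let L : ℝ × ℝ →L[ℝ] E3 := (ContinuousLinearMap.fst ℝ ℝ ℝ).smulRight u +
    (ContinuousLinearMap.snd ℝ ℝ ℝ).smulRight v
  refine ⟨‖L‖₊, LipschitzWith.of_dist_le_mul fun z w => ?_⟩
  have h := L.lipschitz.dist_le_mul z w
  simpa [planeParam, L] using h

/-- A compact subset of a plane has finite two-dimensional Hausdorff measure. -/
theorem hausdorffMeasure_lt_top_of_planar {S : Set E3} (hS : IsCompact S) {n A : E3}
    (hn : ‖n‖ = 1) (hplane : ∀ x ∈ S, dot3 (x - A) n = 0) : μH[(2 : ℝ)] S < ⊤ := by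
  obtain ⟨u, v, huv⟩ := exists_plane_coordinates hn A
  obtain ⟨K, hK⟩ := exists_lipschitzWith_planeParam A u v
  let M : E3 → ℝ × ℝ := fun x => (inner ℝ u (x - A), inner ℝ v (x - A))
  have hM : Continuous M := by fun_prop
  have hsub : S ⊆ planeParam A u v '' (M '' S) := fun x hx =>
    ⟨M x, ⟨x, hx, rfl⟩, huv x (hplane x hx)⟩
  refine (measure_mono hsub).trans_lt
    ((hK.hausdorffMeasure_image_le (by norm_num) (M '' S)).trans_lt ?_)
  rw [hausdorffMeasure_prod_real]
  exact ENNReal.mul_lt_top (by simp) (hS.image hM).measure_lt_top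

theorem analyticOnNhd_eval_planeParam (p : MvPolynomial (Fin 3) ℝ) (A u v : E3) :
    AnalyticOnNhd ℝ (fun z => MvPolynomial.eval (fun i => planeParam A u v z i) p) Set.univ := by
  have h (i : Fin 3) : AnalyticOnNhd ℝ (fun z => planeParam A u v z i) Set.univ := by
    intro z _
    simp only [planeParam, PiLp.add_apply, PiLp.smul_apply, smul_eq_mul]
    exact analyticAt_const.add
      ((analyticAt_fst.mul analyticAt_const).add (analyticAt_snd.mul analyticAt_const))
  simpa [MvPolynomial.aeval_eq_eval] using AnalyticOnNhd.aeval_mvPolynomial h p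

/-- A polynomial vanishing almost everywhere on a subset of a plane with positive
two-dimensional Hausdorff measure vanishes on the whole plane. -/
theorem eval_eq_zero_of_planar {S : Set E3} (hpos : 0 < μH[(2 : ℝ)] S) {n A : E3}
    (hn : ‖n‖ = 1) (hplane : ∀ x ∈ S, dot3 (x - A) n = 0) (p : MvPolynomial (Fin 3) ℝ)
    (hp : μH[(2 : ℝ)] (S ∩ {x | MvPolynomial.eval (fun i => x i) p ≠ 0}) = 0)
    (x : E3) (hx : dot3 (x - A) n = 0) : MvPolynomial.eval (fun i => x i) p = 0 := by
  obtain ⟨u, v, huv⟩ := exists_plane_coordinates hn A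
  obtain ⟨K, hK⟩ := exists_lipschitzWith_planeParam A u v
  suffices h : volume {z | MvPolynomial.eval (fun i => planeParam A u v z i) p = 0} ≠ 0 by
    have := eq_zero_of_volume_zeros_prod_ne_zero (analyticOnNhd_eval_planeParam p A u v) h
      (inner ℝ u (x - A), inner ℝ v (x - A))
    simpa only [planeParam, huv x hx] using this
  intro h0
  have himage : μH[(2 : ℝ)] (planeParam A u v ''
      {z | MvPolynomial.eval (fun i => planeParam A u v z i) p = 0}) = 0 := by
    refine le_antisymm ((hK.hausdorffMeasure_image_le (by norm_num) _).trans ?_) zero_le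
    rw [hausdorffMeasure_prod_real, h0, mul_zero]
  refine hpos.ne' (measure_mono_null (fun y hy => ?_) (measure_union_null hp himage))
  by_cases hy0 : MvPolynomial.eval (fun i => y i) p = 0
  · have hyp : planeParam A u v (inner ℝ u (y - A), inner ℝ v (y - A)) = y := huv y (hplane y hy)
    exact Or.inr ⟨_, by simpa only [Set.mem_ofPred_eq, hyp] using hy0, hyp⟩
  · exact Or.inl ⟨hy, hy0⟩

/-- If the kernel of `f` is contained in that of `g`, then `‖g v‖` is controlled by `‖f v‖` on
finite-dimensional spaces. -/
theorem exists_norm_le_of_ker_le {V F G : Type*} [AddCommGroup V] [Module ℝ V]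
    [FiniteDimensional ℝ V] [NormedAddCommGroup F] [NormedSpace ℝ F] [NormedAddCommGroup G]
    [NormedSpace ℝ G] (f : V →ₗ[ℝ] F) (g : V →ₗ[ℝ] G)
    (h : LinearMap.ker f ≤ LinearMap.ker g) : ∃ C : ℝ, ∀ v, ‖g v‖ ≤ C * ‖f v‖ := by
  let l : LinearMap.range f →L[ℝ] G := LinearMap.toContinuousLinearMap
    ((LinearMap.ker f).liftQ g h ∘ₗ f.quotKerEquivRange.symm.toLinearMap)
  refine ⟨‖l‖, fun v => ?_⟩
  have hl : l ⟨f v, LinearMap.mem_range_self f v⟩ = g v := by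
    simp [l, LinearMap.quotKerEquivRange_symm_apply_image]
  rw [← hl]
  exact l.le_opNorm _

/-- A linear family of square-integrable functions, as a linear map into `L²`. -/
def toL2 {V α : Type*} [AddCommGroup V] [Module ℝ V] [MeasurableSpace α] {μ : Measure α}
    (f : V →ₗ[ℝ] (α → ℝ)) (hf : ∀ v, MemLp (f v) 2 μ) : V →ₗ[ℝ] Lp ℝ 2 μ where
  toFun v := (hf v).toLp (f v)
  map_add' v w := by
    rw [← MemLp.toLp_add (hf v) (hf w)]
    exact MemLp.toLp_congr _ _ (by rw [map_add])
  map_smul' c v := by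
    rw [RingHom.id_apply, ← MemLp.toLp_const_smul c (hf v)]
    exact MemLp.toLp_congr _ _ (by rw [map_smul])

theorem norm_toL2_sq {V α : Type*} [AddCommGroup V] [Module ℝ V] [MeasurableSpace α]
    {μ : Measure α} (f : V →ₗ[ℝ] (α → ℝ)) (hf : ∀ v, MemLp (f v) 2 μ) (v : V) :
    ‖toL2 f hf v‖ ^ 2 = ∫ x, f v x ^ 2 ∂μ := by
  rw [← real_inner_self_eq_norm_sq, L2.inner_def]
  refine integral_congr_ae ?_
  filter_upwards [(hf v).coeFn_toLp] with x hx
  change inner ℝ ((hf v).toLp (f v) x) ((hf v).toLp (f v) x) = _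
  rw [hx, real_inner_self_eq_norm_sq, Real.norm_eq_abs, sq_abs]

/-- On a finite-dimensional space, the `L²` norms of a linear family `g` are controlled by those
of a linear family `f` as soon as `g v` vanishes almost everywhere whenever `f v` does. -/
theorem exists_integral_sq_le {V α β : Type*} [AddCommGroup V] [Module ℝ V]
    [FiniteDimensional ℝ V] [MeasurableSpace α] [MeasurableSpace β] {μ : Measure α}
    {ν : Measure β} (f : V →ₗ[ℝ] (α → ℝ)) (g : V →ₗ[ℝ] (β → ℝ)) (hf : ∀ v, MemLp (f v) 2 μ)
    (hg : ∀ v, MemLp (g v) 2 ν) (h : ∀ v, f v =ᵐ[μ] 0 → g v =ᵐ[ν] 0) :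
    ∃ C : ℝ, ∀ v, ∫ y, g v y ^ 2 ∂ν ≤ C * ∫ x, f v x ^ 2 ∂μ := by
  have hker : LinearMap.ker (toL2 f hf) ≤ LinearMap.ker (toL2 g hg) := fun v hv =>
    ((hg v).toLp_eq_toLp_iff MemLp.zero).2
      (h v (((hf v).toLp_eq_toLp_iff MemLp.zero).1 hv))
  obtain ⟨C, hC⟩ := exists_norm_le_of_ker_le _ _ hker
  refine ⟨C ^ 2, fun v => ?_⟩
  rw [← norm_toL2_sq f hf, ← norm_toL2_sq g hg, ← mul_pow]
  exact pow_le_pow_left₀ (norm_nonneg _) (hC v) 2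

/-- A continuous function is in every `L^p` over a bounded set of finite measure. -/
theorem memLp_restrict_of_continuous {s : Set E3} (hs : MeasurableSet s)
    (hb : Bornology.IsBounded s) {μ : Measure E3} (hμ : μ s < ⊤) {f : E3 → ℝ}
    (hf : Continuous f) (p : ENNReal) : MemLp f p (μ.restrict s) := by
  have : IsFiniteMeasure (μ.restrict s) := ⟨by simpa using hμ⟩
  obtain ⟨C, hC⟩ := hb.isCompact_closure.exists_bound_of_continuousOn hf.continuousOn
  refine MemLp.of_bound hf.aestronglyMeasurable C ?_
  filter_upwards [ae_restrict_mem hs] with x hx using hC x (subset_closure hx)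

/-- Evaluation of polynomials of degree at most `k` as functions on `ℝ³`. -/
def evalLinear (k : ℕ) : MvPolynomial.restrictTotalDegree (Fin 3) ℝ k →ₗ[ℝ] (E3 → ℝ) where
  toFun p x := MvPolynomial.eval (fun i => x i) p.1
  map_add' p q := by ext x; simp
  map_smul' c p := by ext x; simp

theorem continuous_evalLinear {k : ℕ} (p : MvPolynomial.restrictTotalDegree (Fin 3) ℝ k) :
    Continuous (evalLinear k p) :=
  (MvPolynomial.continuous_eval p.1).comp (by fun_prop)

theorem PolyFun.exists_evalLinear {k : ℕ} {f : E3 → ℝ} (hf : PolyFun k f) :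
    ∃ p, evalLinear k p = f := by
  obtain ⟨p, hp, hpf⟩ := hf
  exact ⟨⟨p, (MvPolynomial.mem_restrictTotalDegree _ _ _).2 hp⟩, funext fun x => (hpf x).symm⟩

namespace PolyhedralElement

variable {N : ℕ} (P : PolyhedralElement N)

theorem hT_pos : 0 < P.hT := by
  obtain ⟨x, hx⟩ := P.carrier_nonempty
  exact Metric.diam_pos (infinite_of_mem_nhds x (P.carrier_isOpen.mem_nhds hx)).nontrivial
    P.carrier_isBounded

theorem continuous_faceBubble (j : Fin N) : Continuous (P.faceBubble j) := by
  unfold faceBubble lfun dot3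
  fun_prop

theorem continuous_faceProj (j : Fin N) : Continuous (P.faceProj j) := by
  unfold faceProj dot3
  fun_prop

theorem dot3_faceProj (j : Fin N) (x : E3) :
    dot3 (P.faceProj j x - P.basept j) (P.normal j) = 0 := by
  simp only [faceProj, dot3_eq_inner, sub_right_comm x, inner_sub_right, inner_smul_right,
    real_inner_self_eq_norm_sq, P.normal_unit]
  ring

end PolyhedralElement

/-- for `ψ(X) = (σ_b − σ₀)(π_j(X)) · φ_{f_j}(X) · n_j` one has
`‖ψ‖²_{L²(T)} ≤ C h_T ∫_{f_j} (σ_b − σ₀)² dS`, with `C` depending only on the element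
and `k`. -/
theorem statement7 {N : ℕ} (P : PolyhedralElement N) (j : Fin N) (k : ℕ) :
    ∃ C : ℝ, ∀ σ₀ : E3 → ℝ, PolyFun k σ₀ → ∀ σb : E3 → ℝ, PolyFun k σb →
      (∫ x in P.carrier,
        ‖((σb (P.faceProj j x) - σ₀ (P.faceProj j x)) * P.faceBubble j x) • P.normal j‖ ^ 2) ≤
      C * P.hT * ∫ x in P.face j, (σb x - σ₀ x) ^ 2 ∂(μH[(2 : ℝ)]) := by
  let f := evalLinear k
  let g : MvPolynomial.restrictTotalDegree (Fin 3) ℝ k →ₗ[ℝ] (E3 → ℝ) :=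
    { toFun := fun p x => f p (P.faceProj j x) * P.faceBubble j x
      map_add' := fun p q => by ext x; simp [add_mul]
      map_smul' := fun c p => by ext x; simp [mul_assoc] }
  have hfin : μH[(2 : ℝ)] (P.face j) < ⊤ :=
    hausdorffMeasure_lt_top_of_planar (P.face_isCompact j) (P.normal_unit j) (P.face_planar j)
  have hmeas : MeasurableSet (P.face j) := (P.face_isCompact j).measurableSet
  obtain ⟨C, hC⟩ := exists_integral_sq_le (μ := μH[(2 : ℝ)].restrict (P.face j))
    (ν := volume.restrict P.carrier) f g
    (fun p => memLp_restrict_of_continuous hmeas (P.face_isCompact j).isBounded hfin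
      (continuous_evalLinear p) 2)
    (fun p => memLp_restrict_of_continuous P.carrier_isOpen.measurableSet P.carrier_isBounded
      P.carrier_isBounded.measure_lt_top
      (((continuous_evalLinear p).comp (P.continuous_faceProj j)).mul
        (P.continuous_faceBubble j)) 2)
    (fun p hp => by
      have hp' : μH[(2 : ℝ)]
          (P.face j ∩ {x | MvPolynomial.eval (fun i => x i) p.1 ≠ 0}) = 0 := by
        have h := (ae_restrict_iff' hmeas).1 hp
        rw [ae_iff] at h
        convert h using 2
        ext x
        simp [f, evalLinear]
      refine Filter.Eventually.of_forall fun x => ?_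
      have h0 : f p (P.faceProj j x) = 0 :=
        eval_eq_zero_of_planar (P.face_pos j) (P.normal_unit j) (P.face_planar j) p.1 hp' _
          (P.dot3_faceProj j x)
      change f p (P.faceProj j x) * P.faceBubble j x = 0
      rw [h0, zero_mul])
  refine ⟨C / P.hT, fun σ₀ h₀ σb hb => ?_⟩
  obtain ⟨p₀, rfl⟩ := h₀.exists_evalLinear
  obtain ⟨pb, rfl⟩ := hb.exists_evalLinear
  rw [div_mul_cancel₀ _ P.hT_pos.ne']
  convert hC (pb - p₀) using 3 with x
  · rw [norm_smul, P.normal_unit, mul_one, Real.norm_eq_abs, sq_abs]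
    simp [g, f]
  · simp [f]

end
end

section
/- Let T be a polyhedral element with faces f₁,…,f_N, associated affine functions l₁,…,l_N, and face bubble φ_{f_j} = ∏_{i≠j} l_i² for a fixed face f_j. Let w : ℝ³ → ℝ³ be a continuously differentiable vector field and set q = l_j φ_{f_j} w. Then: (i) q vanishes at every point of every face f_i, i = 1,…,N (hence on all of ∂T); (ii) ∇×q vanishes at every point of f_i for each i ≠ j; and (iii) at every point of f_j, ∇×q = φ_{f_j} (∇l_j × w). -/
open MeasureTheory

noncomputable section

theorem pd_mul {f g : E3 → ℝ} {x : E3} (hf : DifferentiableAt ℝ f x)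
    (hg : DifferentiableAt ℝ g x) (i : Fin 3) :
    pd i (fun y => f y * g y) x = f x * pd i g x + g x * pd i f x := by
  simp [pd, fderiv_fun_mul hf hg]

/-- The product rule `∇×(g v) = g ∇×v + ∇g × v`. -/
theorem curl3_smul {g : E3 → ℝ} {v : E3 → E3} {x : E3} (hg : DifferentiableAt ℝ g x)
    (hv : DifferentiableAt ℝ v x) :
    curl3 (fun y => g y • v y) x = g x • curl3 v x + cross3 (grad3 g x) (v x) := by
  have hvc (c : Fin 3) : DifferentiableAt ℝ (fun y => v y c) x := by fun_prop
  ext c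
  fin_cases c <;>
    simp [curl3, cross3, grad3, pd_mul hg (hvc _)] <;> ring

theorem grad3_mul {f g : E3 → ℝ} {x : E3} (hf : DifferentiableAt ℝ f x)
    (hg : DifferentiableAt ℝ g x) :
    grad3 (fun y => f y * g y) x = f x • grad3 g x + g x • grad3 f x := by
  ext c
  fin_cases c <;> simp [grad3, pd_mul hf hg]

theorem cross3_zero_left (a : E3) : cross3 0 a = 0 := by
  ext c
  fin_cases c <;> simp [cross3]

theorem cross3_smul_left (r : ℝ) (a b : E3) : cross3 (r • a) b = r • cross3 a b := by
  ext c
  fin_cases c <;> simp [cross3] <;> ring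

namespace PolyhedralElement

variable {N : ℕ} (P : PolyhedralElement N)

theorem differentiable_lfun (i : Fin N) : Differentiable ℝ (P.lfun i) := by
  unfold lfun dot3
  simp only [PiLp.sub_apply]
  fun_prop

theorem differentiable_faceBubble (j : Fin N) : Differentiable ℝ (P.faceBubble j) := by
  unfold faceBubble
  have := P.differentiable_lfun
  fun_prop

theorem lfun_eq_zero {i : Fin N} {x : E3} (hx : x ∈ P.face i) : P.lfun i x = 0 := by
  simp [lfun, P.face_planar i x hx]

theorem faceBubble_eq_zero {i j : Fin N} (hij : i ≠ j) {x : E3} (hx : x ∈ P.face i) :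
    P.faceBubble j x = 0 :=
  Finset.prod_eq_zero (Finset.mem_erase.2 ⟨hij, Finset.mem_univ i⟩)
    (by simp [P.lfun_eq_zero hx])

theorem grad3_faceBubble_eq_zero {i j : Fin N} (hij : i ≠ j) {x : E3} (hx : x ∈ P.face i) :
    grad3 (P.faceBubble j) x = 0 := by
  have hl := P.differentiable_lfun
  have hfac : P.faceBubble j = fun y => P.lfun i y *
      (P.lfun i y * ∏ k ∈ (Finset.univ.erase j).erase i, P.lfun k y ^ 2) := by
    funext y
    rw [faceBubble, ← Finset.mul_prod_erase _ _ (Finset.mem_erase.2 ⟨hij, Finset.mem_univ i⟩)]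
    ring
  rw [hfac, grad3_mul (by fun_prop) (by fun_prop), P.lfun_eq_zero hx]
  simp

end PolyhedralElement

/-- for `q = l_j φ_{f_j} w` with `w` a `C¹` vector field: (i) `q` vanishes on
every face; (ii) `∇×q` vanishes on every face `f_i` with `i ≠ j`; (iii) on `f_j`,
`∇×q = φ_{f_j} (∇l_j × w)`. -/
theorem statement15 {N : ℕ} (P : PolyhedralElement N) (j : Fin N)
    (w : E3 → E3) (hw : ContDiff ℝ 1 w) :
    (∀ i : Fin N, ∀ x ∈ P.face i,
        (P.lfun j x * P.faceBubble j x) • w x = 0) ∧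
    (∀ i : Fin N, i ≠ j → ∀ x ∈ P.face i,
        curl3 (fun X => (P.lfun j X * P.faceBubble j X) • w X) x = 0) ∧
    ∀ x ∈ P.face j,
        curl3 (fun X => (P.lfun j X * P.faceBubble j X) • w X) x =
          P.faceBubble j x • cross3 (grad3 (P.lfun j) x) (w x) := by
  have hl := P.differentiable_lfun j
  have hb := P.differentiable_faceBubble j
  have hwd : Differentiable ℝ w := hw.differentiable one_ne_zero
  refine ⟨fun i x hx => ?_, fun i hij x hx => ?_, fun x hx => ?_⟩
  · obtain rfl | hij := eq_or_ne i j
    · simp [P.lfun_eq_zero hx]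
    · simp [P.faceBubble_eq_zero hij hx]
  · rw [curl3_smul ((hl x).fun_mul (hb x)) (hwd x), grad3_mul (hl x) (hb x),
      P.faceBubble_eq_zero hij hx, P.grad3_faceBubble_eq_zero hij hx]
    simp [cross3_zero_left]
  · rw [curl3_smul ((hl x).fun_mul (hb x)) (hwd x), grad3_mul (hl x) (hb x),
      P.lfun_eq_zero hx]
    simp [cross3_smul_left]

end
end
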